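/- arXiv:1808.04496 — 2 statements merged into one kernel-verified Lean document; each statement's English description precedes it below -/
import Mathlib

section
/- Let X be a finite set and N ≥ 2 an integer with N ≤ |X|. Let B_N(X) = { λ ∈ ℝ^X : λᵀ𝟏 = 1 and λ(i) ∈ {0, 1/N} for each i ∈ X }, and let Γ̃₂ = { (N/(N−1)) λλᵀ − (1/(N−1)) diag*(λ) : λ ∈ B_N(X) }. Then conv(Γ̃₂) = { γ ∈ ℝ^{X×X} : γ is an N-representable 2-marginal and diag(γ) = 0 }. -/
/-- The set of `N`-representable 2-marginals: matrices obtained by marginalizing a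
symmetric probability distribution on `X^N` onto its first two coordinates. -/
def NRep2Marginals (X : Type*) [Fintype X] [DecidableEq X] (N : ℕ) (hN : 2 ≤ N) :
    Set (Matrix X X ℝ) :=
  { γ | ∃ μ : (Fin N → X) → ℝ,
      (∀ z, 0 ≤ μ z) ∧ (∑ z, μ z = 1) ∧
      (∀ (σ : Equiv.Perm (Fin N)) (z : Fin N → X), μ (z ∘ σ) = μ z) ∧
      (∀ x y : X, γ x y =
        ∑ z ∈ Finset.univ.filter
          (fun z : Fin N → X => z ⟨0, by omega⟩ = x ∧ z ⟨1, by omega⟩ = y), μ z) }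

/-- The set of binarized probability vectors on `X` with entries in `{0, 1/N}`. -/
def BN (X : Type*) [Fintype X] (N : ℕ) : Set (X → ℝ) :=
  { l | (∑ i, l i = 1) ∧ ∀ i, l i = 0 ∨ l i = 1 / N }

/-- The set `Γ̃₂`. -/
def GammaTilde2 (X : Type*) [Fintype X] [DecidableEq X] (N : ℕ) : Set (Matrix X X ℝ) :=
  { γ | ∃ l ∈ BN X N,
      γ = ((N : ℝ) / ((N : ℝ) - 1)) • Matrix.vecMulVec l l
          - (1 / ((N : ℝ) - 1)) • Matrix.diagonal l }

open Finset in
/-- A symmetric function on `ι → X` has the same marginal on every pair of distinct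
coordinates. -/
lemma sum_pair_marginal_eq {ι X R : Type*} [Fintype ι] [DecidableEq ι] [Fintype X]
    [DecidableEq X] [AddCommMonoid R] {μ : (ι → X) → R}
    (hμ : ∀ (σ : Equiv.Perm ι) (z : ι → X), μ (z ∘ σ) = μ z)
    {i j k l : ι} (hij : i ≠ j) (hkl : k ≠ l) (x y : X) :
    ∑ z with z i = x ∧ z j = y, μ z = ∑ z with z k = x ∧ z l = y, μ z := by
  obtain ⟨σ, hk, hl⟩ : ∃ σ : Equiv.Perm ι, σ k = i ∧ σ l = j := by
    refine ⟨Equiv.swap (Equiv.swap k i l) j * Equiv.swap k i, ?_, by simp⟩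
    have h : i ≠ Equiv.swap k i l := by
      intro h
      exact hkl ((Equiv.swap k i).injective (by simpa using h))
    simp [Equiv.swap_apply_of_ne_of_ne h hij]
  rw [sum_filter, sum_filter,
    ← Equiv.sum_comp (Equiv.arrowCongr σ.symm (Equiv.refl X))
      fun z => if z k = x ∧ z l = y then _ else _]
  refine sum_congr rfl fun z _ => ?_
  have he : Equiv.arrowCongr σ.symm (Equiv.refl X) z = z ∘ σ := rfl
  simp [he, hμ, hk, hl]

/-- The empirical distribution of a tuple. -/
noncomputable def empirical {X : Type*} [DecidableEq X] {N : ℕ} (z : Fin N → X) (x : X) : ℝ :=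
  (∑ i, if z i = x then 1 else 0) / N

/-- The 2-marginal of sampling without replacement from a population with distribution `l`. -/
noncomputable def sampleMarginal {X : Type*} [DecidableEq X] (N : ℕ) (l : X → ℝ) :
    Matrix X X ℝ :=
  ((N : ℝ) / ((N : ℝ) - 1)) • Matrix.vecMulVec l l - (1 / ((N : ℝ) - 1)) • Matrix.diagonal l

lemma sampleMarginal_apply {X : Type*} [DecidableEq X] (N : ℕ) (l : X → ℝ) (x y : X) :
    sampleMarginal N l x y =
      (N : ℝ) / ((N : ℝ) - 1) * (l x * l y) - 1 / ((N : ℝ) - 1) * if x = y then l x else 0 := by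
  simp [sampleMarginal, Matrix.vecMulVec_apply, Matrix.diagonal_apply]

lemma sampleMarginal_diag_eq_zero {X : Type*} [Fintype X] [DecidableEq X] {N : ℕ} (hN : 2 ≤ N)
    {l : X → ℝ} (hl : l ∈ BN X N) (x : X) : sampleMarginal N l x x = 0 := by
  have h2 : (2 : ℝ) ≤ N := by exact_mod_cast hN
  have h0 : (N : ℝ) ≠ 0 := by linarith
  have h1 : (N : ℝ) - 1 ≠ 0 := by linarith
  rw [sampleMarginal_apply]
  rcases hl.2 x with h | h
  · simp [h]
  · rw [h, if_pos rfl]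
    field_simp
    ring

lemma empirical_comp_perm {X : Type*} [DecidableEq X] {N : ℕ} (z : Fin N → X)
    (σ : Equiv.Perm (Fin N)) : empirical (z ∘ σ) = empirical z := by
  funext x
  simp only [empirical, Function.comp_apply]
  rw [Equiv.sum_comp σ (fun i => if z i = x then (1 : ℝ) else 0)]

/-- The marginal of the empirical distribution of a tuple counts ordered pairs of distinct
coordinates. -/
lemma mul_sampleMarginal_empirical {X : Type*} [DecidableEq X] {N : ℕ} (hN : 2 ≤ N)
    (z : Fin N → X) (x y : X) :
    ((N : ℝ) * (N - 1)) * sampleMarginal N (empirical z) x y =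
      ∑ i, ∑ j, if i ≠ j ∧ z i = x ∧ z j = y then (1 : ℝ) else 0 := by
  have h2 : (2 : ℝ) ≤ N := by exact_mod_cast hN
  have h0 : (N : ℝ) ≠ 0 := by linarith
  have h1 : (N : ℝ) - 1 ≠ 0 := by linarith
  have key : (∑ i, ∑ j, if i ≠ j ∧ z i = x ∧ z j = y then (1 : ℝ) else 0) =
      (∑ i, if z i = x then (1 : ℝ) else 0) * (∑ j, if z j = y then (1 : ℝ) else 0)
        - if x = y then ∑ i, if z i = x then (1 : ℝ) else 0 else 0 := by
    rw [Finset.sum_mul_sum]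
    have hdiag : (if x = y then ∑ i, if z i = x then (1 : ℝ) else 0 else 0) =
        ∑ i, ∑ j, if i = j then (if x = y ∧ z i = x then (1 : ℝ) else 0) else 0 := by
      simp only [Finset.sum_ite_eq, Finset.mem_univ, if_true]
      split_ifs with h <;> simp [h]
    rw [hdiag, ← Finset.sum_sub_distrib]
    refine Finset.sum_congr rfl fun i _ => ?_
    rw [← Finset.sum_sub_distrib]
    refine Finset.sum_congr rfl fun j _ => ?_
    grind
  rw [key, sampleMarginal_apply]
  simp only [empirical]
  split_ifs <;> field_simp <;> simp

/-- The 2-marginal of a symmetric distribution is the corresponding mixture of the marginals of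
empirical distributions. -/
lemma pair_marginal_eq_sum_sampleMarginal {X : Type*} [Fintype X] [DecidableEq X] {N : ℕ}
    (hN : 2 ≤ N) {μ : (Fin N → X) → ℝ}
    (hμ : ∀ (σ : Equiv.Perm (Fin N)) (z : Fin N → X), μ (z ∘ σ) = μ z)
    {k l : Fin N} (hkl : k ≠ l) (x y : X) :
    ∑ z with z k = x ∧ z l = y, μ z = ∑ z, μ z * sampleMarginal N (empirical z) x y := by
  have h2 : (2 : ℝ) ≤ N := by exact_mod_cast hN
  have h0 : (N : ℝ) * (N - 1) ≠ 0 := mul_ne_zero (by linarith) (by linarith)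
  apply mul_left_cancel₀ h0
  rw [Finset.mul_sum _ (fun z => μ z * _)]
  simp only [mul_left_comm _ (μ _), mul_sampleMarginal_empirical hN, Finset.mul_sum Finset.univ]
  rw [Finset.sum_comm]
  simp_rw [Finset.sum_comm (s := (Finset.univ : Finset (Fin N → X)))]
  have hterm : ∀ i j : Fin N,
      (∑ z, μ z * if i ≠ j ∧ z i = x ∧ z j = y then (1 : ℝ) else 0) =
        (∑ z with z k = x ∧ z l = y, μ z) -
          if i = j then ∑ z with z k = x ∧ z l = y, μ z else 0 := by
    intro i j
    by_cases hij : i = j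
    · simp [hij]
    · rw [← sum_pair_marginal_eq hμ hij hkl x y, Finset.sum_filter]
      simp [hij]
  simp_rw [hterm, Finset.sum_sub_distrib]
  simp
  ring

lemma empirical_mem_BN {X : Type*} [Fintype X] [DecidableEq X] {N : ℕ} (hN : N ≠ 0)
    {z : Fin N → X} (hz : Function.Injective z) : empirical z ∈ BN X N := by
  refine ⟨?_, fun x => ?_⟩
  · simp only [empirical]
    rw [← Finset.sum_div, Finset.sum_comm]
    simp [hN]
  · by_cases hx : ∃ i, z i = x
    · obtain ⟨i, rfl⟩ := hx
      right
      simp [empirical, hz.eq_iff]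
    · left
      push Not at hx
      simp [empirical, hx]

lemma exists_empirical_eq {X : Type*} [Fintype X] [DecidableEq X] {N : ℕ} (hN : N ≠ 0)
    {l : X → ℝ} (hl : l ∈ BN X N) : ∃ z : Fin N → X, empirical z = l := by
  have hN' : (N : ℝ) ≠ 0 := by exact_mod_cast hN
  have hval : ∀ x, l x = if l x ≠ 0 then 1 / (N : ℝ) else 0 := by
    intro x
    rcases hl.2 x with h | h <;> simp [h, hN]
  have hcard : (Finset.univ.filter fun x => l x ≠ 0).card = N := by
    have h := hl.1
    rw [Finset.sum_congr rfl fun x _ => hval x, ← Finset.sum_filter, Finset.sum_const,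
      nsmul_eq_mul] at h
    field_simp at h
    exact_mod_cast h
  let e := (Finset.univ.filter fun x => l x ≠ 0).equivFinOfCardEq hcard
  refine ⟨fun i => e.symm i, funext fun x => ?_⟩
  rw [hval x, empirical, Equiv.sum_comp e.symm (fun s => if (s : X) = x then (1 : ℝ) else 0),
    Finset.sum_coe_sort _ (fun s => if s = x then (1 : ℝ) else 0)]
  simp [Finset.sum_ite_eq', ite_div]

lemma sampleMarginal_empirical_mem_NRep2Marginals {X : Type*} [Fintype X] [DecidableEq X] {N : ℕ}
    (hN : 2 ≤ N) (z : Fin N → X) :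
    sampleMarginal N (empirical z) ∈ NRep2Marginals X N hN := by
  have hpos : (0 : ℝ) < Fintype.card (Equiv.Perm (Fin N)) := by exact_mod_cast Fintype.card_pos
  let μ : (Fin N → X) → ℝ := fun w =>
    ∑ σ : Equiv.Perm (Fin N), if w = z ∘ σ then 1 / (Fintype.card (Equiv.Perm (Fin N)) : ℝ) else 0
  have hsum : ∀ f : (Fin N → X) → ℝ, ∑ w, μ w * f w =
      ∑ σ : Equiv.Perm (Fin N), 1 / (Fintype.card (Equiv.Perm (Fin N)) : ℝ) * f (z ∘ σ) := by
    intro f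
    simp only [μ, Finset.sum_mul]
    rw [Finset.sum_comm]
    simp
  have hsymm : ∀ (σ : Equiv.Perm (Fin N)) (w : Fin N → X), μ (w ∘ σ) = μ w := by
    intro σ w
    simp only [μ]
    rw [← Equiv.sum_comp (Equiv.mulRight σ)]
    refine Finset.sum_congr rfl fun τ _ => ?_
    have h : w ∘ σ = z ∘ (τ * σ : Equiv.Perm (Fin N)) ↔ w = z ∘ τ := by
      rw [Equiv.Perm.coe_mul, ← Function.comp_assoc]
      exact σ.surjective.injective_comp_right.eq_iff
    simp only [Equiv.coe_mulRight, h]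
  refine ⟨μ, fun w => Finset.sum_nonneg fun σ _ => by split_ifs <;> positivity, ?_, hsymm,
    fun x y => ?_⟩
  · have h := hsum fun _ => 1
    simp only [mul_one] at h
    rw [h, Finset.sum_const, nsmul_eq_mul, Finset.card_univ]
    field_simp
  · rw [pair_marginal_eq_sum_sampleMarginal hN hsymm (by simp) x y,
      hsum fun w => sampleMarginal N (empirical w) x y]
    simp only [empirical_comp_perm]
    rw [Finset.sum_const, nsmul_eq_mul, Finset.card_univ]
    field_simp

lemma convex_NRep2Marginals (X : Type*) [Fintype X] [DecidableEq X] (N : ℕ) (hN : 2 ≤ N) :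
    Convex ℝ (NRep2Marginals X N hN) := by
  rintro γ ⟨μ, h0, h1, hs, hm⟩ γ' ⟨μ', h0', h1', hs', hm'⟩ a b ha hb hab
  refine ⟨fun z => a * μ z + b * μ' z, fun z => ?_, ?_, fun σ z => ?_, fun x y => ?_⟩
  · exact add_nonneg (mul_nonneg ha (h0 z)) (mul_nonneg hb (h0' z))
  · rw [Finset.sum_add_distrib, ← Finset.mul_sum, ← Finset.mul_sum, h1, h1']
    simpa using hab
  · simp only [hs, hs']
  · rw [Finset.sum_add_distrib, ← Finset.mul_sum, ← Finset.mul_sum, ← hm, ← hm']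
    simp

theorem convexHull_GammaTilde2_eq
    (X : Type*) [Fintype X] [DecidableEq X] (N : ℕ) (hN : 2 ≤ N)
    (hNX : N ≤ Fintype.card X) :
    convexHull ℝ (GammaTilde2 X N)
      = { γ : Matrix X X ℝ | γ ∈ NRep2Marginals X N hN ∧ ∀ i, γ i i = 0 } := by
  have hN0 : N ≠ 0 := by omega
  apply Set.Subset.antisymm
  · apply convexHull_min
    · rintro _ ⟨l, hl, rfl⟩
      refine ⟨?_, sampleMarginal_diag_eq_zero hN hl⟩
      obtain ⟨z, rfl⟩ := exists_empirical_eq hN0 hl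
      exact sampleMarginal_empirical_mem_NRep2Marginals hN z
    · rintro γ ⟨hγ, hd⟩ γ' ⟨hγ', hd'⟩ a b ha hb hab
      exact ⟨convex_NRep2Marginals X N hN hγ hγ' ha hb hab, fun i => by simp [hd, hd']⟩
  · rintro γ ⟨⟨μ, h0, h1, hs, hm⟩, hd⟩
    have hinj : ∀ z, μ z ≠ 0 → Function.Injective z := by
      intro z hz i j hij
      by_contra hne
      have h := hd (z j)
      rw [hm, ← sum_pair_marginal_eq hs hne (by simp) (z j) (z j),
        Finset.sum_eq_zero_iff_of_nonneg fun w _ => h0 w] at h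
      exact hz (h z (by simp [hij]))
    have hγ : γ = ∑ z with μ z ≠ 0, μ z • sampleMarginal N (empirical z) := by
      ext x y
      rw [hm, pair_marginal_eq_sum_sampleMarginal hN hs (by simp) x y, Matrix.sum_apply]
      simp only [Matrix.smul_apply, smul_eq_mul]
      refine (Finset.sum_filter_of_ne fun z _ hz => ?_).symm
      exact left_ne_zero_of_mul hz
    rw [hγ]
    refine (convex_convexHull ℝ _).sum_mem (fun z _ => h0 z) ?_ fun z hz => ?_
    · rw [Finset.sum_filter_ne_zero, h1]
    · exact subset_convexHull ℝ _
        ⟨empirical z, empirical_mem_BN hN0 (hinj z (by simpa using hz)), rfl⟩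
end

section
/- Let X be a finite set with |X| elements and N ≥ 2 an integer with N ≤ |X|. Let Π̃_{N,sym}(ρ) = { μ ∈ Π̃_{N,sym} : Σ_{i₂,...,i_N ∈ X} μ(i₁,i₂,...,i_N) = ρ(i₁) for all i₁ ∈ X }, where ρ ∈ ℝ^X is a fixed probability vector. Then every extreme point of Π̃_{N,sym}(ρ) can be written as a convex combination of at most |X| elements of Γ̃_N = { (1/N!) Σ_{σ ∈ S(N)} e_{c_{σ(1)}} ⊗ ⋯ ⊗ e_{c_{σ(N)}} : c₁,...,c_N ∈ X pairwise distinct }. -/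
/-- Symmetric probability distributions on `X^N` vanishing whenever two indices coincide. -/
def PiTildeSym (X : Type*) [Fintype X] [DecidableEq X] (N : ℕ) :
    Set ((Fin N → X) → ℝ) :=
  { μ | (∀ z, 0 ≤ μ z) ∧ (∑ z, μ z = 1) ∧
      (∀ (σ : Equiv.Perm (Fin N)) (z : Fin N → X), μ (z ∘ σ) = μ z) ∧
      (∀ z : Fin N → X, (∃ k l : Fin N, k ≠ l ∧ z k = z l) → μ z = 0) }

/-- The symmetrized point masses on pairwise-distinct configurations. -/
def GammaTildeN (X : Type*) [Fintype X] [DecidableEq X] (N : ℕ) :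
    Set ((Fin N → X) → ℝ) :=
  { μ | ∃ c : Fin N → X, Function.Injective c ∧
      μ = fun z => (1 / (N.factorial : ℝ)) *
        ∑ σ : Equiv.Perm (Fin N), ∏ k, (if z k = c (σ k) then (1 : ℝ) else 0) }

/-- `Π̃_{N,sym}(ρ)`: elements of `Π̃_{N,sym}` whose 1-marginal is `ρ`. -/
def PiTildeSymRho (X : Type*) [Fintype X] [DecidableEq X] (N : ℕ) (hN : 2 ≤ N)
    (ρ : X → ℝ) : Set ((Fin N → X) → ℝ) :=
  { μ | μ ∈ PiTildeSym X N ∧ ∀ i : X,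
      (∑ z ∈ Finset.univ.filter (fun z : Fin N → X => z ⟨0, by omega⟩ = i), μ z) = ρ i }

theorem convex_PiTildeSym (X : Type*) [Fintype X] [DecidableEq X] (N : ℕ) :
    Convex ℝ (PiTildeSym X N) := by
  rintro x ⟨hx0, hx1, hxs, hxd⟩ y ⟨hy0, hy1, hys, hyd⟩ a b ha hb hab
  refine ⟨fun z => ?_, ?_, fun σ z => ?_, fun z hz => ?_⟩
  · exact add_nonneg (mul_nonneg ha (hx0 z)) (mul_nonneg hb (hy0 z))
  · simp [Finset.sum_add_distrib, ← Finset.mul_sum, hx1, hy1, hab]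
  · simp [hxs, hys]
  · simp [hxd z hz, hyd z hz]

theorem prod_ite_eq_comp {X : Type*} [DecidableEq X] {N : ℕ} (c z : Fin N → X)
    (σ : Equiv.Perm (Fin N)) :
    ∏ k, (if z k = c (σ k) then (1 : ℝ) else 0) = if z = c ∘ σ then 1 else 0 := by
  simp [Finset.prod_boole, funext_iff]

theorem GammaTildeN_subset_PiTildeSym (X : Type*) [Fintype X] [DecidableEq X] (N : ℕ) :
    GammaTildeN X N ⊆ PiTildeSym X N := by
  rintro _ ⟨c, hc, rfl⟩
  simp only [prod_ite_eq_comp]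
  refine ⟨fun z => by positivity, ?_, fun τ z => ?_, ?_⟩
  · rw [← Finset.mul_sum, Finset.sum_comm]
    simp [Fintype.card_perm, Nat.factorial_ne_zero]
  · refine congrArg (1 / (N.factorial : ℝ) * ·) ?_
    refine Fintype.sum_equiv (Equiv.mulRight τ⁻¹) _ _ fun σ => ?_
    congr 1
    rw [eq_iff_iff]
    constructor
    · intro h
      ext k
      simpa using congrFun h (τ⁻¹ k)
    · rintro rfl
      ext k
      simp
  · rintro z ⟨k, l, hkl, hz⟩
    refine mul_eq_zero_of_right _ (Finset.sum_eq_zero fun σ _ => if_neg ?_)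
    rintro rfl
    exact hkl (σ.injective (hc hz))

/-- A symmetric tensor is its own symmetrization, hence an average of symmetrized point masses. -/
theorem PiTildeSym_subset_convexHull (X : Type*) [Fintype X] [DecidableEq X] (N : ℕ) :
    PiTildeSym X N ⊆ convexHull ℝ (GammaTildeN X N) := by
  rintro μ ⟨h0, h1, hs, hd⟩
  let G : (Fin N → X) → (Fin N → X) → ℝ := fun c z => (1 / (N.factorial : ℝ)) *
    ∑ σ : Equiv.Perm (Fin N), ∏ k, (if z k = c (σ k) then (1 : ℝ) else 0)
  have hinj : ∀ c, μ c ≠ 0 → Function.Injective c := by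
    intro c hc k l hkl
    by_contra hne
    exact hc (hd c ⟨k, l, hne, hkl⟩)
  have hμ : ∑ c, μ c • G c = μ := by
    ext z
    simp only [G, prod_ite_eq_comp, Finset.sum_apply, Pi.smul_apply, smul_eq_mul]
    have key : ∀ σ : Equiv.Perm (Fin N),
        ∑ c : Fin N → X, μ c * (if z = c ∘ σ then (1 : ℝ) else 0) = μ z := by
      intro σ
      rw [Finset.sum_eq_single (z ∘ σ.symm)]
      · rw [if_pos (by ext k; simp), mul_one, hs]
      · intro c _ hc
        rw [if_neg, mul_zero]
        rintro rfl
        exact hc (by ext k; simp)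
      · simp
    calc ∑ c, μ c * (1 / (N.factorial : ℝ) *
            ∑ σ : Equiv.Perm (Fin N), if z = c ∘ σ then (1 : ℝ) else 0)
        = 1 / (N.factorial : ℝ) * ∑ σ : Equiv.Perm (Fin N),
            ∑ c : Fin N → X, μ c * (if z = c ∘ σ then (1 : ℝ) else 0) := by
          rw [Finset.sum_comm, Finset.mul_sum]
          refine Finset.sum_congr rfl fun c _ => ?_
          rw [← Finset.mul_sum]
          ring
      _ = μ z := by
          simp only [key]
          simp [Fintype.card_perm, Nat.factorial_ne_zero]
  have hfilter : ∑ c with μ c ≠ 0, μ c • G c = μ := by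
    rw [Finset.sum_filter_of_ne, hμ]
    rintro c - h hc
    exact h (by rw [hc, zero_smul])
  rw [← hfilter]
  refine (convex_convexHull ℝ _).sum_mem (fun c _ => h0 c) ?_ fun c hc => ?_
  · rw [Finset.sum_filter_ne_zero, h1]
  · exact subset_convexHull ℝ _ ⟨c, hinj c (by simpa using hc), rfl⟩

/-- If a point of a convex set `K` is extreme in the fibre of a linear map `f`, then any positive
convex combination of affinely independent points of `K` representing it has at most
`finrank F` terms, provided linear relations among the images under `f` have weight zero. -/
theorem card_le_finrank_of_mem_extremePoints {E F ι : Type*} [AddCommGroup E] [Module ℝ E]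
    [AddCommGroup F] [Module ℝ F] [FiniteDimensional ℝ F] [Fintype ι] {K : Set E}
    (hK : Convex ℝ K) (f : E →ₗ[ℝ] F) {y : F} {p : ι → E} {w : ι → ℝ} (hp : ∀ i, p i ∈ K)
    (hind : AffineIndependent ℝ p) (hw : ∀ i, 0 < w i) (hw1 : ∑ i, w i = 1)
    (hf : ∀ d : ι → ℝ, ∑ i, d i • f (p i) = 0 → ∑ i, d i = 0)
    (hx : ∑ i, w i • p i ∈ Set.extremePoints ℝ {x ∈ K | f x = y}) :
    Fintype.card ι ≤ Module.finrank ℝ F := by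
  by_contra! hcard
  have hker : LinearMap.ker (Fintype.linearCombination ℝ (f ∘ p)) ≠ ⊥ :=
    LinearMap.ker_ne_bot_of_finrank_lt (by simpa using hcard)
  obtain ⟨d, hd, hd0⟩ := (Submodule.ne_bot_iff _).mp hker
  replace hd : ∑ i, d i • f (p i) = 0 := by
    simpa [Fintype.linearCombination_apply] using hd
  have hdsum := hf d hd
  have hev : ∀ᶠ ε : ℝ in nhdsWithin 0 (Set.Ioi 0), ∀ i, |ε * d i| < w i := by
    refine Filter.eventually_all.2 fun i => Filter.Eventually.filter_mono nhdsWithin_le_nhds ?_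
    have hcont : Continuous fun ε : ℝ => |ε * d i| := by fun_prop
    exact hcont.continuousAt.eventually_lt continuousAt_const (by simpa using hw i)
  obtain ⟨ε, hε, hε0⟩ := (hev.and self_mem_nhdsWithin).exists
  have hmem : ∀ s : ℝ, |s| = 1 →
      ∑ i, w i • p i + (s * ε) • ∑ i, d i • p i ∈ {x ∈ K | f x = y} := by
    intro s hs
    refine ⟨?_, ?_⟩
    · have hrw : ∑ i, w i • p i + (s * ε) • ∑ i, d i • p i
          = ∑ i, (w i + s * ε * d i) • p i := by
        simp only [add_smul, Finset.sum_add_distrib, Finset.smul_sum, mul_smul]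
      rw [hrw]
      refine hK.sum_mem (fun i _ => ?_) ?_ fun i _ => hp i
      · have h : |s * ε * d i| < w i := by
          rw [mul_assoc, abs_mul, hs, one_mul]
          exact hε i
        linarith [neg_abs_le (s * ε * d i)]
      · rw [Finset.sum_add_distrib, ← Finset.mul_sum, hdsum, hw1, mul_zero, add_zero]
    · have hz : f (∑ i, d i • p i) = 0 := by simpa using hd
      rw [map_add, map_smul, hz, smul_zero, add_zero]
      exact hx.1.2
  have heq := hx.2 (hmem 1 (by simp)) (hmem (-1) (by simp))
    ⟨1 / 2, 1 / 2, by norm_num, by norm_num, by norm_num, by module⟩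
  have hzero : ∑ i, d i • p i = 0 := by
    have hε' : ε ≠ 0 := ne_of_gt hε0
    simpa [hε'] using heq
  exact hd0 (funext fun i => hind.eq_zero_of_sum_eq_zero hdsum hzero i (Finset.mem_univ i))

/-- The `k`-th marginal of a tensor on `X^N`, as a linear map. -/
def marginalMap (X : Type*) [Fintype X] [DecidableEq X] {N : ℕ} (k : Fin N) :
    ((Fin N → X) → ℝ) →ₗ[ℝ] (X → ℝ) where
  toFun μ i := ∑ z ∈ Finset.univ.filter (fun z : Fin N → X => z k = i), μ z
  map_add' μ ν := by
    ext i
    simp [Finset.sum_add_distrib]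
  map_smul' r μ := by
    ext i
    simp [Finset.mul_sum]

theorem sum_marginalMap {X : Type*} [Fintype X] [DecidableEq X] {N : ℕ} (k : Fin N)
    (μ : (Fin N → X) → ℝ) : ∑ i, marginalMap X k μ i = ∑ z, μ z :=
  Finset.sum_fiberwise _ _ _

/-- A convex combination can be padded with zero weights to a prescribed number of terms. -/
theorem exists_convexCombination_of_card_le {E ι κ : Type*} [AddCommGroup E] [Module ℝ E]
    [Fintype ι] [Fintype κ] (hcard : Fintype.card ι ≤ Fintype.card κ) {s : Set E}
    (hs : s.Nonempty) {p : ι → E} {w : ι → ℝ} (hp : ∀ i, p i ∈ s) (hw : ∀ i, 0 ≤ w i)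
    (hw1 : ∑ i, w i = 1) :
    ∃ (a : κ → ℝ) (g : κ → E), (∀ j, 0 ≤ a j) ∧ ∑ j, a j = 1 ∧ (∀ j, g j ∈ s) ∧
      ∑ i, w i • p i = ∑ j, a j • g j := by
  obtain ⟨e⟩ := Function.Embedding.nonempty_of_card_le hcard
  obtain ⟨x₀, hx₀⟩ := hs
  have ha0 : ∀ j ∉ Set.range e, Function.extend e w 0 j = 0 :=
    fun j hj => Function.extend_apply' _ _ _ hj
  refine ⟨Function.extend e w 0, Function.extend e p fun _ => x₀, fun j => ?_, ?_, fun j => ?_, ?_⟩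
  · by_cases hj : j ∈ Set.range e
    · obtain ⟨i, rfl⟩ := hj
      rw [e.injective.extend_apply]
      exact hw i
    · rw [ha0 j hj]
  · rw [← hw1]
    exact (Fintype.sum_of_injective e e.injective _ _ ha0
      fun i => (e.injective.extend_apply _ _ i).symm).symm
  · by_cases hj : j ∈ Set.range e
    · obtain ⟨i, rfl⟩ := hj
      rw [e.injective.extend_apply]
      exact hp i
    · rwa [Function.extend_apply' _ _ _ hj]
  · refine Fintype.sum_of_injective e e.injective _ _ (fun j hj => ?_) fun i => ?_
    · rw [ha0 j hj, zero_smul]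
    · rw [e.injective.extend_apply, e.injective.extend_apply]

theorem GammaTildeN_nonempty {X : Type*} [Fintype X] [DecidableEq X] {N : ℕ}
    (hNX : N ≤ Fintype.card X) : (GammaTildeN X N).Nonempty := by
  obtain ⟨c⟩ := Function.Embedding.nonempty_of_card_le (α := Fin N) (β := X) (by simpa using hNX)
  exact ⟨_, c, c.injective, rfl⟩

theorem extremePoint_is_convexCombination_of_card_elements
    (X : Type*) [Fintype X] [DecidableEq X] (N : ℕ) (hN : 2 ≤ N)
    (hNX : N ≤ Fintype.card X)
    (ρ : X → ℝ) (hρpos : ∀ i, 0 ≤ ρ i) (hρsum : ∑ i, ρ i = 1)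
    (μ : (Fin N → X) → ℝ)
    (hμ : μ ∈ Set.extremePoints ℝ (PiTildeSymRho X N hN ρ)) :
    ∃ (a : Fin (Fintype.card X) → ℝ) (g : Fin (Fintype.card X) → (Fin N → X) → ℝ),
      (∀ i, 0 ≤ a i) ∧ (∑ i, a i = 1) ∧ (∀ i, g i ∈ GammaTildeN X N) ∧
      μ = ∑ i, a i • g i := by
  obtain ⟨ι, _, p, w, hp, hind, hw, hw1, rfl⟩ :=
    eq_pos_convex_span_of_mem_convexHull (PiTildeSym_subset_convexHull X N hμ.1.1)
  have hpGamma : ∀ i, p i ∈ GammaTildeN X N := fun i => hp ⟨i, rfl⟩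
  have hpPi : ∀ i, p i ∈ PiTildeSym X N := fun i => GammaTildeN_subset_PiTildeSym X N (hpGamma i)
  let k₀ : Fin N := ⟨0, by omega⟩
  have hset : PiTildeSymRho X N hN ρ = {x ∈ PiTildeSym X N | marginalMap X k₀ x = ρ} := by
    ext x
    exact and_congr_right fun _ => funext_iff.symm
  rw [hset] at hμ
  have hcard := card_le_finrank_of_mem_extremePoints (convex_PiTildeSym X N) (marginalMap X k₀)
    hpPi hind hw hw1 (fun d hd => ?_) hμ
  · exact exists_convexCombination_of_card_le (by simpa using hcard) (GammaTildeN_nonempty hNX)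
      hpGamma (fun i => (hw i).le) hw1
  · have hsum := congrArg (fun v : X → ℝ => ∑ x, v x) hd
    simp only [Finset.sum_apply, Pi.smul_apply, smul_eq_mul, Pi.zero_apply,
      Finset.sum_const_zero] at hsum
    rw [Finset.sum_comm] at hsum
    simpa [← Finset.mul_sum, sum_marginalMap, (hpPi _).2.1] using hsum
end
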